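/- For 0 < ε < 1/2, the hexagon H_ε = conv{(ε,0), (1−ε,0), (1−ε,ε), (ε,1−ε), (0,1−ε), (0,ε)} is a Delzant polygon whose vertex set is exactly these six points; its six edges, taken in cyclic order, have rational lengths 1−2ε, ε, 1−2ε, ε, 1−2ε, ε; in particular, every vertex of H_ε has at least one incident edge of rational length exactly ε, and hence no vertex of H_ε has both incident edges of rational length strictly greater than ε. -/

import Mathlib

open MeasureTheory

noncomputable section

/-- The real vector in `ℝ²` corresponding to an integer vector in `ℤ²`. -/
def intVec (u : ℤ × ℤ) : ℝ × ℝ := ((u.1 : ℝ), (u.2 : ℝ))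

/-- `RatLenIs w ℓ` : the vector `w` lies on a line of rational slope and has rational
length `ℓ`, i.e. `ℓ > 0` and `w / ℓ` is a primitive vector of `ℤ²` (coprime coordinates). -/
def RatLenIs (w : ℝ × ℝ) (ℓ : ℝ) : Prop :=
  0 < ℓ ∧ ∃ u : ℤ × ℤ, IsCoprime u.1 u.2 ∧ w = ℓ • intVec u

/-- The closed segment `[a, b]`, with `a ≠ b`, is an edge (a one-dimensional face,
i.e. an extreme subset which is a nondegenerate segment) of the convex set `P`. -/
def IsEdge (P : Set (ℝ × ℝ)) (a b : ℝ × ℝ) : Prop :=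
  a ≠ b ∧ IsExtreme ℝ P (segment ℝ a b)

/-- `u ∈ ℤ²` is a direction of an edge of `P` emanating from the vertex `v`. -/
def EdgeDir (P : Set (ℝ × ℝ)) (v : ℝ × ℝ) (u : ℤ × ℤ) : Prop :=
  ∃ w, IsEdge P v w ∧ ∃ ℓ : ℝ, 0 < ℓ ∧ w - v = ℓ • intVec u

/-- The Delzant condition at the vertex `v` of `P`, witnessed by `u₁, u₂` : these are the
primitive integer vectors pointing from `v` along the two edges of `P` incident to `v`,
and they form a `ℤ`-basis of `ℤ²` (their determinant is `±1`). -/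
def DelzantAt (P : Set (ℝ × ℝ)) (v : ℝ × ℝ) (u₁ u₂ : ℤ × ℤ) : Prop :=
  IsCoprime u₁.1 u₁.2 ∧ IsCoprime u₂.1 u₂.2 ∧
  EdgeDir P v u₁ ∧ EdgeDir P v u₂ ∧
  (u₁.1 * u₂.2 - u₁.2 * u₂.1 = 1 ∨ u₁.1 * u₂.2 - u₁.2 * u₂.1 = -1) ∧
  ∀ u : ℤ × ℤ, IsCoprime u.1 u.2 → EdgeDir P v u → u = u₁ ∨ u = u₂

/-- `V` is the (finite) vertex set of a Delzant polygon `P = conv V ⊆ ℝ²`: `P` is a compact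
convex polygon with nonempty interior, its set of vertices (extreme points) is exactly `V`,
and at each vertex the primitive directions of the two incident edges form a `ℤ`-basis of
`ℤ²`; in particular every edge has rational slope. -/
def IsDelzantPolygon (V : Set (ℝ × ℝ)) : Prop :=
  V.Finite ∧ (interior (convexHull ℝ V)).Nonempty ∧
  Set.extremePoints ℝ (convexHull ℝ V) = V ∧
  ∀ v ∈ V, ∃ u₁ u₂ : ℤ × ℤ, DelzantAt (convexHull ℝ V) v u₁ u₂

/-- The new vertex set `(V ∖ {v}) ∪ {v + ε·u₁, v + ε·u₂}` of the `ε`-corner chop at `v`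
of the polygon with vertex set `V`. -/
def chopSet (V : Set (ℝ × ℝ)) (v : ℝ × ℝ) (u₁ u₂ : ℤ × ℤ) (ε : ℝ) : Set (ℝ × ℝ) :=
  (V \ {v}) ∪ {v + ε • intVec u₁, v + ε • intVec u₂}

/-- The polygon with vertex set `W` is an `ε`-corner chop of the Delzant polygon with
vertex set `V` at some vertex `v` whose two incident edges both have rational length
strictly greater than `ε`. -/
def IsCornerChop (V W : Set (ℝ × ℝ)) (ε : ℝ) : Prop :=
  0 < ε ∧ ∃ v ∈ V, ∃ u₁ u₂ : ℤ × ℤ,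
    DelzantAt (convexHull ℝ V) v u₁ u₂ ∧
    (∀ w ℓ, IsEdge (convexHull ℝ V) v w → RatLenIs (w - v) ℓ → ε < ℓ) ∧
    convexHull ℝ W = convexHull ℝ (chopSet V v u₁ u₂ ε)

/-- The vertex set of the standard triangle `Δ = conv {(0,0), (1,0), (0,1)}`. -/
def stdTri : Set (ℝ × ℝ) := {(0, 0), (1, 0), (0, 1)}

theorem IsEdge.symm {P : Set (ℝ × ℝ)} {v w : ℝ × ℝ} (h : IsEdge P v w) : IsEdge P w v :=
  ⟨h.1.symm, segment_symm ℝ v w ▸ h.2⟩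

/-- The face of `P` on which the linear functional `a x + b y` attains its minimum `c` is an edge
when it is a nondegenerate segment. -/
theorem isEdge_of_supporting_line {P : Set (ℝ × ℝ)} (hP : Convex ℝ P) {v w : ℝ × ℝ} (a b c : ℝ)
    (hne : v ≠ w) (hv : v ∈ P) (hw : w ∈ P)
    (hvc : a * v.1 + b * v.2 = c) (hwc : a * w.1 + b * w.2 = c)
    (hle : ∀ p ∈ P, c ≤ a * p.1 + b * p.2)
    (hface : ∀ p ∈ P, a * p.1 + b * p.2 = c → p ∈ segment ℝ v w) : IsEdge P v w := by
  refine ⟨hne, hP.segment_subset hv hw, ?_⟩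
  rintro x hx y hy z ⟨s', t', hs', ht', hst', rfl⟩ ⟨s, t, hs, ht, hst, hz⟩
  apply hface x hx
  have hx' := hle x hx
  have hy' := hle y hy
  have hz1 := congrArg Prod.fst hz
  have hz2 := congrArg Prod.snd hz
  simp only [Prod.fst_add, Prod.smul_fst, Prod.snd_add, Prod.smul_snd, smul_eq_mul] at hz1 hz2
  have key : s' * (a * v.1 + b * v.2) + t' * (a * w.1 + b * w.2)
      = s * (a * x.1 + b * x.2) + t * (a * y.1 + b * y.2) := by
    linear_combination -a * hz1 - b * hz2
  rw [hvc, hwc, ← add_mul, hst', one_mul] at key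
  have : s * (a * x.1 + b * x.2 - c) ≤ 0 := by
    have := mul_nonneg ht.le (sub_nonneg.2 hy')
    have hc : c = s * c + t * c := by rw [← add_mul, hst, one_mul]
    linarith
  nlinarith

theorem mem_segment_of_fst_eq {v w p : ℝ × ℝ} (hv : v.1 = p.1) (hw : w.1 = p.1)
    (h1 : v.2 ≤ p.2) (h2 : p.2 ≤ w.2) : p ∈ segment ℝ v w := by
  obtain ⟨v1, v2⟩ := v
  obtain ⟨w1, w2⟩ := w
  obtain ⟨p1, p2⟩ := p
  dsimp only at *
  subst hv hw
  have : p2 ∈ segment ℝ v2 w2 := by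
    rw [segment_eq_Icc (h1.trans h2)]
    exact ⟨h1, h2⟩
  obtain ⟨s, t, hs, ht, hst, rfl⟩ := this
  exact ⟨s, t, hs, ht, hst, by ext <;> simp [← add_mul, hst]⟩

/-- A point of a line `a x + b y = c` with `b ≠ 0` lies on a segment of that line as soon as
its first coordinate lies between those of the endpoints. -/
theorem mem_segment_of_line {v w p : ℝ × ℝ} (a b c : ℝ) (hb : b ≠ 0)
    (hv : a * v.1 + b * v.2 = c) (hw : a * w.1 + b * w.2 = c) (hp : a * p.1 + b * p.2 = c)
    (h1 : v.1 ≤ p.1) (h2 : p.1 ≤ w.1) : p ∈ segment ℝ v w := by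
  have : p.1 ∈ segment ℝ v.1 w.1 := by
    rw [segment_eq_Icc (h1.trans h2)]
    exact ⟨h1, h2⟩
  obtain ⟨s, t, hs, ht, hst, h⟩ := this
  refine ⟨s, t, hs, ht, hst, Prod.ext h ?_⟩
  simp only [smul_eq_mul, Prod.snd_add, Prod.smul_snd] at h ⊢
  apply mul_left_cancel₀ hb
  linear_combination s * hv + t * hw - hp - a * h + c * hst

/-- The apex of a cone spanned by two vectors of determinant `1` is an extreme point of every
set contained in the cone. -/
theorem mem_extremePoints_of_cone {P : Set (ℝ × ℝ)} {v : ℝ × ℝ} {u₁ u₂ : ℤ × ℤ} (hv : v ∈ P)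
    (hdet : u₁.1 * u₂.2 - u₁.2 * u₂.1 = 1)
    (h₁ : ∀ p ∈ P, 0 ≤ (p.1 - v.1) * u₂.2 - (p.2 - v.2) * u₂.1)
    (h₂ : ∀ p ∈ P, 0 ≤ u₁.1 * (p.2 - v.2) - u₁.2 * (p.1 - v.1)) :
    v ∈ Set.extremePoints ℝ P := by
  have hd : (u₁.1 : ℝ) * u₂.2 - u₁.2 * u₂.1 = 1 := by exact_mod_cast hdet
  refine ⟨hv, ?_⟩
  rintro x hx y hy ⟨s, t, hs, ht, hst, hz⟩
  have hz1 := congrArg Prod.fst hz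
  have hz2 := congrArg Prod.snd hz
  simp only [Prod.fst_add, Prod.smul_fst, Prod.snd_add, Prod.smul_snd, smul_eq_mul] at hz1 hz2
  have aux : ∀ α β : ℝ, 0 ≤ α → 0 ≤ β → s * α + t * β = 0 → α = 0 := by
    intro α β hα hβ h
    have := mul_nonneg ht.le hβ
    nlinarith
  have e₁ := aux _ _ (h₁ x hx) (h₁ y hy) (by
    linear_combination (u₂.2 : ℝ) * hz1 - u₂.1 * hz2 - (v.1 * u₂.2 - v.2 * u₂.1) * hst)
  have e₂ := aux _ _ (h₂ x hx) (h₂ y hy) (by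
    linear_combination (u₁.1 : ℝ) * hz2 - u₁.2 * hz1 - (u₁.1 * v.2 - u₁.2 * v.1) * hst)
  ext
  · linear_combination (u₁.1 : ℝ) * e₁ + u₂.1 * e₂ - (x.1 - v.1) * hd
  · linear_combination (u₁.2 : ℝ) * e₁ + u₂.2 * e₂ - (x.2 - v.2) * hd

theorem add_smul_mem_of_edge {P : Set (ℝ × ℝ)} {v w z : ℝ × ℝ} {l s : ℝ}
    (h : IsEdge P v w) (hl : 0 < l) (hw : w - v = l • z) (hs : 0 ≤ s) (hsl : s ≤ l) :
    v + s • z ∈ P := by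
  refine h.2.1 ?_
  rw [segment_eq_image']
  exact ⟨s / l, ⟨by positivity, (div_le_one hl).2 hsl⟩, by
    simp only [hw, smul_smul, div_mul_cancel₀ s hl.ne']⟩

/-- A vertex of a polygon contained in the cone spanned by two of its edges there, with primitive
directions of determinant `1`, satisfies the Delzant condition. -/
theorem delzantAt_of_cone {P : Set (ℝ × ℝ)} {v w₁ w₂ : ℝ × ℝ} {u₁ u₂ : ℤ × ℤ} {l₁ l₂ : ℝ}
    (he₁ : IsEdge P v w₁) (he₂ : IsEdge P v w₂) (hl₁ : 0 < l₁) (hl₂ : 0 < l₂)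
    (hw₁ : w₁ - v = l₁ • intVec u₁) (hw₂ : w₂ - v = l₂ • intVec u₂)
    (hdet : u₁.1 * u₂.2 - u₁.2 * u₂.1 = 1)
    (h₁ : ∀ p ∈ P, 0 ≤ (p.1 - v.1) * u₂.2 - (p.2 - v.2) * u₂.1)
    (h₂ : ∀ p ∈ P, 0 ≤ u₁.1 * (p.2 - v.2) - u₁.2 * (p.1 - v.1)) :
    DelzantAt P v u₁ u₂ := by
  refine ⟨⟨u₂.2, -u₂.1, by linarith⟩, ⟨-u₁.2, u₁.1, by linarith⟩, ⟨w₁, he₁, l₁, hl₁, hw₁⟩,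
    ⟨w₂, he₂, l₂, hl₂, hw₂⟩, Or.inl hdet, ?_⟩
  rintro u hu ⟨w, he, l, hl, hw⟩
  have hd : (u₁.1 : ℝ) * u₂.2 - u₁.2 * u₂.1 = 1 := by exact_mod_cast hdet
  obtain ⟨a, ha⟩ : ∃ a, a = u.1 * u₂.2 - u.2 * u₂.1 := ⟨_, rfl⟩
  obtain ⟨b, hb⟩ : ∃ b, b = u₁.1 * u.2 - u₁.2 * u.1 := ⟨_, rfl⟩
  have hu1 : u.1 = a * u₁.1 + b * u₂.1 := by
    rw [ha, hb]
    linear_combination -u.1 * hdet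
  have hu2 : u.2 = a * u₁.2 + b * u₂.2 := by
    rw [ha, hb]
    linear_combination -u.2 * hdet
  have hwP : w ∈ P := he.2.1 (right_mem_segment ℝ v w)
  have hw1 : w.1 - v.1 = l * u.1 := by simpa [intVec] using congrArg Prod.fst hw
  have hw2 : w.2 - v.2 = l * u.2 := by simpa [intVec] using congrArg Prod.snd hw
  have ha0 : 0 ≤ a := by
    have h := h₁ w hwP
    have e : (w.1 - v.1) * u₂.2 - (w.2 - v.2) * u₂.1 = l * (a : ℝ) := by
      rw [hw1, hw2, ha]
      push_cast
      ring
    rw [e] at h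
    exact_mod_cast nonneg_of_mul_nonneg_right h hl
  have hb0 : 0 ≤ b := by
    have h := h₂ w hwP
    have e : u₁.1 * (w.2 - v.2) - u₁.2 * (w.1 - v.1) = l * (b : ℝ) := by
      rw [hw1, hw2, hb]
      push_cast
      ring
    rw [e] at h
    exact_mod_cast nonneg_of_mul_nonneg_right h hl
  have prim : ∀ (k : ℤ) (z : ℤ × ℤ), 0 ≤ k → u.1 = k * z.1 → u.2 = k * z.2 → u = z := by
    intro k z hk e1 e2
    have hk1 : k = 1 := by
      have hunit : IsUnit k := hu.isUnit_of_dvd' ⟨_, e1⟩ ⟨_, e2⟩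
      rcases Int.isUnit_iff.1 hunit with h | h <;> omega
    subst hk1
    exact Prod.ext (by simpa using e1) (by simpa using e2)
  rcases ha0.eq_or_lt with ha' | ha'
  · exact Or.inr (prim b u₂ hb0 (by rw [hu1, ← ha']; ring) (by rw [hu2, ← ha']; ring))
  rcases hb0.eq_or_lt with hb' | hb'
  · exact Or.inl (prim a u₁ ha0 (by rw [hu1, ← hb']; ring) (by rw [hu2, ← hb']; ring))
  exfalso
  have haR : (0 : ℝ) < a := by exact_mod_cast ha'
  have hbR : (0 : ℝ) < b := by exact_mod_cast hb'
  obtain ⟨c, hc, hcl, hca, hcb⟩ : ∃ c : ℝ, 0 < c ∧ c ≤ l ∧ 2 * c * a ≤ l₁ ∧ 2 * c * b ≤ l₂ := by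
    refine ⟨min l (min (l₁ / (2 * a)) (l₂ / (2 * b))), by positivity, min_le_left _ _, ?_, ?_⟩
    · have : min l (min (l₁ / (2 * a)) (l₂ / (2 * b))) ≤ l₁ / (2 * a) :=
        (min_le_right _ _).trans (min_le_left _ _)
      rw [le_div_iff₀ (by positivity)] at this
      linarith
    · have : min l (min (l₁ / (2 * a)) (l₂ / (2 * b))) ≤ l₂ / (2 * b) :=
        (min_le_right _ _).trans (min_le_right _ _)
      rw [le_div_iff₀ (by positivity)] at this
      linarith
  have hx := add_smul_mem_of_edge he₁ hl₁ hw₁ (s := 2 * c * a) (by positivity) hca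
  have hy := add_smul_mem_of_edge he₂ hl₂ hw₂ (s := 2 * c * b) (by positivity) hcb
  have hz : v + c • intVec u ∈ segment ℝ v w := by
    rw [segment_eq_image']
    exact ⟨c / l, ⟨by positivity, (div_le_one hl).2 hcl⟩, by
      simp only [hw, smul_smul, div_mul_cancel₀ c hl.ne']⟩
  have hopen : v + c • intVec u ∈
      openSegment ℝ (v + (2 * c * a) • intVec u₁) (v + (2 * c * b) • intVec u₂) := by
    refine ⟨1 / 2, 1 / 2, by norm_num, by norm_num, by norm_num, ?_⟩
    have hu1' : (u.1 : ℝ) = a * u₁.1 + b * u₂.1 := by exact_mod_cast hu1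
    have hu2' : (u.2 : ℝ) = a * u₁.2 + b * u₂.2 := by exact_mod_cast hu2
    ext
    · simp [intVec, hu1']
      ring
    · simp [intVec, hu2']
      ring
  have hxs := he.2.2 hx hy hz hopen
  rw [segment_eq_image'] at hxs
  obtain ⟨θ, -, hθ⟩ := hxs
  rw [hw] at hθ
  have e1 : θ * (l * u.1) = 2 * c * a * u₁.1 := by simpa [intVec] using congrArg Prod.fst hθ
  have e2 : θ * (l * u.2) = 2 * c * a * u₁.2 := by simpa [intVec] using congrArg Prod.snd hθ
  have hbR' : (b : ℝ) = u₁.1 * u.2 - u₁.2 * u.1 := by exact_mod_cast hb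
  have haR' : (a : ℝ) = u.1 * u₂.2 - u.2 * u₂.1 := by exact_mod_cast ha
  have f1 : θ * l * b = 0 := by
    rw [hbR']
    linear_combination u₁.1 * e2 - u₁.2 * e1
  have f2 : θ * l * a = 2 * c * a := by
    linear_combination u₂.2 * e1 - u₂.1 * e2 + θ * l * haR' + 2 * c * a * hd
  have f3 : θ * l = 0 := (mul_eq_zero.1 f1).resolve_right hbR.ne'
  rw [f3, zero_mul] at f2
  have : 0 < 2 * c * (a : ℝ) := by positivity
  linarith

/-- The vertices of the hexagon `H_ε`, in counterclockwise order. -/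
def hexVertices (ε : ℝ) : Set (ℝ × ℝ) :=
  {(ε, 0), (1 - ε, 0), (1 - ε, ε), (ε, 1 - ε), (0, 1 - ε), (0, ε)}

theorem forall_mem_hexVertices {ε : ℝ} {p : ℝ × ℝ → Prop} :
    (∀ v ∈ hexVertices ε, p v) ↔
      p (ε, 0) ∧ p (1 - ε, 0) ∧ p (1 - ε, ε) ∧ p (ε, 1 - ε) ∧ p (0, 1 - ε) ∧ p (0, ε) := by
  simp [hexVertices]

theorem hexagon_subset {ε : ℝ} (h0 : 0 < ε) (h1 : ε < 1 / 2) {p : ℝ × ℝ}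
    (hp : p ∈ convexHull ℝ (hexVertices ε)) :
    0 ≤ p.1 ∧ 0 ≤ p.2 ∧ ε ≤ p.1 + p.2 ∧ p.1 + p.2 ≤ 1 ∧ p.1 ≤ 1 - ε ∧ p.2 ≤ 1 - ε := by
  have halfplane : ∀ a b c : ℝ, (∀ v ∈ hexVertices ε, c ≤ a * v.1 + b * v.2) →
      c ≤ a * p.1 + b * p.2 := fun a b c h =>
    convexHull_min h (convex_halfSpace_ge
      (f := fun q : ℝ × ℝ => a * q.1 + b * q.2)
      ⟨fun x y => by simp; ring, fun k x => by simp; ring⟩ c) hp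
  simp only [forall_mem_hexVertices] at halfplane
  refine ⟨?_, ?_, ?_, ?_, ?_, ?_⟩
  · linarith [halfplane 1 0 0 (by refine ⟨?_, ?_, ?_, ?_, ?_, ?_⟩ <;> linarith)]
  · linarith [halfplane 0 1 0 (by refine ⟨?_, ?_, ?_, ?_, ?_, ?_⟩ <;> linarith)]
  · linarith [halfplane 1 1 ε (by refine ⟨?_, ?_, ?_, ?_, ?_, ?_⟩ <;> linarith)]
  · linarith [halfplane (-1) (-1) (-1) (by refine ⟨?_, ?_, ?_, ?_, ?_, ?_⟩ <;> linarith)]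
  · linarith [halfplane (-1) 0 (ε - 1) (by refine ⟨?_, ?_, ?_, ?_, ?_, ?_⟩ <;> linarith)]
  · linarith [halfplane 0 (-1) (ε - 1) (by refine ⟨?_, ?_, ?_, ?_, ?_, ?_⟩ <;> linarith)]

theorem hexVertices_subset (ε : ℝ) : ∀ v ∈ hexVertices ε, v ∈ convexHull ℝ (hexVertices ε) :=
  fun _ hv => subset_convexHull ℝ _ hv

theorem hexagon_edges {ε : ℝ} (h0 : 0 < ε) (h1 : ε < 1 / 2) :
    IsEdge (convexHull ℝ (hexVertices ε)) (ε, 0) (1 - ε, 0) ∧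
    IsEdge (convexHull ℝ (hexVertices ε)) (1 - ε, 0) (1 - ε, ε) ∧
    IsEdge (convexHull ℝ (hexVertices ε)) (1 - ε, ε) (ε, 1 - ε) ∧
    IsEdge (convexHull ℝ (hexVertices ε)) (ε, 1 - ε) (0, 1 - ε) ∧
    IsEdge (convexHull ℝ (hexVertices ε)) (0, 1 - ε) (0, ε) ∧
    IsEdge (convexHull ℝ (hexVertices ε)) (0, ε) (ε, 0) := by
  have hP := convex_convexHull ℝ (hexVertices ε)
  obtain ⟨m₀, m₁, m₂, m₃, m₄, m₅⟩ := forall_mem_hexVertices.1 (hexVertices_subset ε)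
  have hs := fun p hp => hexagon_subset h0 h1 (p := p) hp
  refine ⟨?_, ?_, IsEdge.symm ?_, IsEdge.symm ?_, IsEdge.symm ?_, ?_⟩
  · refine isEdge_of_supporting_line hP 0 1 0 (fun h => ?_) m₀ m₁ (by ring) (by ring)
      (fun p hp => ?_) (fun p hp h => mem_segment_of_line 0 1 0 one_ne_zero (by ring) (by ring) h
        ?_ ?_)
    · have := congrArg Prod.fst h
      dsimp only at this
      linarith
    all_goals
      have := hs p hp
      simp -failIfUnchanged only
      linarith
  · refine isEdge_of_supporting_line hP (-1) 0 (ε - 1) (fun h => ?_) m₁ m₂ (by ring) (by ring)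
      (fun p hp => ?_) (fun p hp h => mem_segment_of_fst_eq ?_ ?_ ?_ ?_)
    · have := congrArg Prod.snd h
      dsimp only at this
      linarith
    all_goals
      have := hs p hp
      simp -failIfUnchanged only
      linarith
  · refine isEdge_of_supporting_line hP (-1) (-1) (-1) (fun h => ?_) m₃ m₂ (by ring) (by ring)
      (fun p hp => ?_) (fun p hp h => mem_segment_of_line (-1) (-1) (-1) (by simp) (by ring)
        (by ring) h ?_ ?_)
    · have := congrArg Prod.fst h
      dsimp only at this
      linarith
    all_goals
      have := hs p hp
      simp -failIfUnchanged only
      linarith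
  · refine isEdge_of_supporting_line hP 0 (-1) (ε - 1) (fun h => ?_) m₄ m₃ (by ring) (by ring)
      (fun p hp => ?_) (fun p hp h => mem_segment_of_line 0 (-1) (ε - 1) (by simp) (by ring)
        (by ring) h ?_ ?_)
    · have := congrArg Prod.fst h
      dsimp only at this
      linarith
    all_goals
      have := hs p hp
      simp -failIfUnchanged only
      linarith
  · refine isEdge_of_supporting_line hP 1 0 0 (fun h => ?_) m₅ m₄ (by ring) (by ring)
      (fun p hp => ?_) (fun p hp h => mem_segment_of_fst_eq ?_ ?_ ?_ ?_)
    · have := congrArg Prod.snd h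
      dsimp only at this
      linarith
    all_goals
      have := hs p hp
      simp -failIfUnchanged only
      linarith
  · refine isEdge_of_supporting_line hP 1 1 ε (fun h => ?_) m₅ m₀ (by ring) (by ring)
      (fun p hp => ?_) (fun p hp h => mem_segment_of_line 1 1 ε (by simp) (by ring)
        (by ring) h ?_ ?_)
    · have := congrArg Prod.fst h
      dsimp only at this
      linarith
    all_goals
      have := hs p hp
      simp -failIfUnchanged only
      linarith

theorem hexagon_vertex_cones {ε : ℝ} (h0 : 0 < ε) (h1 : ε < 1 / 2) :
    ∀ v ∈ hexVertices ε, v ∈ Set.extremePoints ℝ (convexHull ℝ (hexVertices ε)) ∧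
      ∃ u₁ u₂ : ℤ × ℤ, DelzantAt (convexHull ℝ (hexVertices ε)) v u₁ u₂ := by
  obtain ⟨m₀, m₁, m₂, m₃, m₄, m₅⟩ := forall_mem_hexVertices.1 (hexVertices_subset ε)
  obtain ⟨e₀, e₁, e₂, e₃, e₄, e₅⟩ := hexagon_edges h0 h1
  have hs := fun p hp => hexagon_subset h0 h1 (p := p) hp
  have h2 : 0 < 1 - 2 * ε := by linarith
  have vertex : ∀ {v w₁ w₂ : ℝ × ℝ} (u₁ u₂ : ℤ × ℤ) {l₁ l₂ : ℝ},
      v ∈ convexHull ℝ (hexVertices ε) →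
      IsEdge (convexHull ℝ (hexVertices ε)) v w₁ → IsEdge (convexHull ℝ (hexVertices ε)) v w₂ →
      0 < l₁ → 0 < l₂ → w₁ - v = l₁ • intVec u₁ → w₂ - v = l₂ • intVec u₂ →
      u₁.1 * u₂.2 - u₁.2 * u₂.1 = 1 →
      (∀ p ∈ convexHull ℝ (hexVertices ε), 0 ≤ (p.1 - v.1) * u₂.2 - (p.2 - v.2) * u₂.1 ∧
        0 ≤ u₁.1 * (p.2 - v.2) - u₁.2 * (p.1 - v.1)) →
      v ∈ Set.extremePoints ℝ (convexHull ℝ (hexVertices ε)) ∧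
        ∃ u₁ u₂ : ℤ × ℤ, DelzantAt (convexHull ℝ (hexVertices ε)) v u₁ u₂ :=
    fun u₁ u₂ _ _ hv he₁ he₂ hl₁ hl₂ hw₁ hw₂ hdet h =>
      ⟨mem_extremePoints_of_cone hv hdet (fun p hp => (h p hp).1) (fun p hp => (h p hp).2),
        u₁, u₂, delzantAt_of_cone he₁ he₂ hl₁ hl₂ hw₁ hw₂ hdet
          (fun p hp => (h p hp).1) (fun p hp => (h p hp).2)⟩
  refine forall_mem_hexVertices.2 ⟨
    vertex (1, 0) (-1, 1) m₀ e₀ e₅.symm h2 h0 ?_ ?_ (by norm_num) fun p hp => ?_,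
    vertex (0, 1) (-1, 0) m₁ e₁ e₀.symm h0 h2 ?_ ?_ (by norm_num) fun p hp => ?_,
    vertex (-1, 1) (0, -1) m₂ e₂ e₁.symm h2 h0 ?_ ?_ (by norm_num) fun p hp => ?_,
    vertex (-1, 0) (1, -1) m₃ e₃ e₂.symm h0 h2 ?_ ?_ (by norm_num) fun p hp => ?_,
    vertex (0, -1) (1, 0) m₄ e₄ e₃.symm h2 h0 ?_ ?_ (by norm_num) fun p hp => ?_,
    vertex (1, -1) (0, 1) m₅ e₅ e₄.symm h0 h2 ?_ ?_ (by norm_num) fun p hp => ?_⟩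
  all_goals first
  | have := hs p hp
    push_cast
    constructor <;> linarith
  | ext <;> simp [intVec] <;> ring

theorem interior_hexagon_nonempty {ε : ℝ} (h0 : 0 < ε) (h1 : ε < 1 / 2) :
    (interior (convexHull ℝ (hexVertices ε))).Nonempty := by
  rw [interior_convexHull_nonempty_iff_affineSpan_eq_top, eq_top_iff]
  rintro ⟨x, y⟩ -
  obtain ⟨m₀, m₁, -, -, -, m₅⟩ := forall_mem_hexVertices.1
    fun v (hv : v ∈ hexVertices ε) => subset_affineSpan ℝ (hexVertices ε) hv
  have d₁ := AffineSubspace.vsub_mem_direction m₁ m₀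
  have d₅ := AffineSubspace.vsub_mem_direction m₅ m₀
  have h2 : 1 - 2 * ε ≠ 0 := by linarith
  have := AffineSubspace.vadd_mem_of_mem_direction
    (add_mem (Submodule.smul_mem _ ((x - ε + y) / (1 - 2 * ε)) d₁)
      (Submodule.smul_mem _ (y / ε) d₅)) m₀
  convert this using 1
  ext
  · have e : (x - ε + y) / (1 - 2 * ε) * (1 - 2 * ε) = x - ε + y := div_mul_cancel₀ _ h2
    have e' : y / ε * ε = y := div_mul_cancel₀ _ h0.ne'
    simp only [vsub_eq_sub, vadd_eq_add, Prod.fst_add, Prod.smul_fst, Prod.fst_sub, smul_eq_mul]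
    linear_combination e' - e
  · simp
    field_simp

theorem isDelzantPolygon_hexVertices {ε : ℝ} (h0 : 0 < ε) (h1 : ε < 1 / 2) :
    IsDelzantPolygon (hexVertices ε) :=
  ⟨by simp [hexVertices], interior_hexagon_nonempty h0 h1,
    extremePoints_convexHull_subset.antisymm fun v hv => (hexagon_vertex_cones h0 h1 v hv).1,
    fun v hv => (hexagon_vertex_cones h0 h1 v hv).2⟩

theorem hexagon_short_edge {ε : ℝ} (h0 : 0 < ε) (h1 : ε < 1 / 2) :
    ∀ v ∈ hexVertices ε, ∃ w, IsEdge (convexHull ℝ (hexVertices ε)) v w ∧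
      RatLenIs (w - v) ε := by
  obtain ⟨-, e₁, -, e₃, -, e₅⟩ := hexagon_edges h0 h1
  refine forall_mem_hexVertices.2
    ⟨⟨_, e₅.symm, h0, (-1, 1), ?_, ?_⟩, ⟨_, e₁, h0, (0, 1), ?_, ?_⟩,
      ⟨_, e₁.symm, h0, (0, -1), ?_, ?_⟩, ⟨_, e₃, h0, (-1, 0), ?_, ?_⟩,
      ⟨_, e₃.symm, h0, (1, 0), ?_, ?_⟩, ⟨_, e₅, h0, (1, -1), ?_, ?_⟩⟩
  all_goals first
  | exact Int.isCoprime_iff_gcd_eq_one.2 rfl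
  | ext <;> simp [intVec]

/-- for `0 < ε < 1/2`, the hexagon
`H_ε = conv {(ε,0), (1−ε,0), (1−ε,ε), (ε,1−ε), (0,1−ε), (0,ε)}` is a Delzant polygon with
vertex set exactly these six points; its six edges, in cyclic order, have rational lengths
`1−2ε, ε, 1−2ε, ε, 1−2ε, ε`; in particular every vertex of `H_ε` has an incident edge of
rational length exactly `ε`, hence no vertex has both incident edges of rational length
strictly greater than `ε`. -/
theorem delzant_hexagon (ε : ℝ) (h0 : 0 < ε) (h1 : ε < 1 / 2) :
    IsDelzantPolygon
      ({(ε, 0), (1 - ε, 0), (1 - ε, ε), (ε, 1 - ε), (0, 1 - ε), (0, ε)} : Set (ℝ × ℝ)) ∧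
    Set.extremePoints ℝ (convexHull ℝ
        ({(ε, 0), (1 - ε, 0), (1 - ε, ε), (ε, 1 - ε), (0, 1 - ε), (0, ε)} : Set (ℝ × ℝ)))
      = ({(ε, 0), (1 - ε, 0), (1 - ε, ε), (ε, 1 - ε), (0, 1 - ε), (0, ε)} : Set (ℝ × ℝ)) ∧
    IsEdge (convexHull ℝ
        ({(ε, 0), (1 - ε, 0), (1 - ε, ε), (ε, 1 - ε), (0, 1 - ε), (0, ε)} : Set (ℝ × ℝ)))
        (ε, 0) (1 - ε, 0) ∧
      RatLenIs ((1 - ε, (0 : ℝ)) - (ε, 0)) (1 - 2 * ε) ∧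
    IsEdge (convexHull ℝ
        ({(ε, 0), (1 - ε, 0), (1 - ε, ε), (ε, 1 - ε), (0, 1 - ε), (0, ε)} : Set (ℝ × ℝ)))
        (1 - ε, 0) (1 - ε, ε) ∧
      RatLenIs ((1 - ε, ε) - ((1 : ℝ) - ε, (0 : ℝ))) ε ∧
    IsEdge (convexHull ℝ
        ({(ε, 0), (1 - ε, 0), (1 - ε, ε), (ε, 1 - ε), (0, 1 - ε), (0, ε)} : Set (ℝ × ℝ)))
        (1 - ε, ε) (ε, 1 - ε) ∧
      RatLenIs ((ε, 1 - ε) - ((1 : ℝ) - ε, ε)) (1 - 2 * ε) ∧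
    IsEdge (convexHull ℝ
        ({(ε, 0), (1 - ε, 0), (1 - ε, ε), (ε, 1 - ε), (0, 1 - ε), (0, ε)} : Set (ℝ × ℝ)))
        (ε, 1 - ε) (0, 1 - ε) ∧
      RatLenIs (((0 : ℝ), 1 - ε) - (ε, 1 - ε)) ε ∧
    IsEdge (convexHull ℝ
        ({(ε, 0), (1 - ε, 0), (1 - ε, ε), (ε, 1 - ε), (0, 1 - ε), (0, ε)} : Set (ℝ × ℝ)))
        (0, 1 - ε) (0, ε) ∧
      RatLenIs (((0 : ℝ), ε) - (0, 1 - ε)) (1 - 2 * ε) ∧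
    IsEdge (convexHull ℝ
        ({(ε, 0), (1 - ε, 0), (1 - ε, ε), (ε, 1 - ε), (0, 1 - ε), (0, ε)} : Set (ℝ × ℝ)))
        (0, ε) (ε, 0) ∧
      RatLenIs ((ε, (0 : ℝ)) - (0, ε)) ε ∧
    (∀ v ∈ ({(ε, 0), (1 - ε, 0), (1 - ε, ε), (ε, 1 - ε), (0, 1 - ε), (0, ε)} : Set (ℝ × ℝ)),
      (∃ w, IsEdge (convexHull ℝ
          ({(ε, 0), (1 - ε, 0), (1 - ε, ε), (ε, 1 - ε), (0, 1 - ε), (0, ε)} : Set (ℝ × ℝ)))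
          v w ∧ RatLenIs (w - v) ε) ∧
      ¬ (∀ w ℓ, IsEdge (convexHull ℝ
          ({(ε, 0), (1 - ε, 0), (1 - ε, ε), (ε, 1 - ε), (0, 1 - ε), (0, ε)} : Set (ℝ × ℝ)))
          v w → RatLenIs (w - v) ℓ → ε < ℓ)) := by
  obtain ⟨e₀, e₁, e₂, e₃, e₄, e₅⟩ := hexagon_edges h0 h1
  have hD := isDelzantPolygon_hexVertices h0 h1
  have h2 : 0 < 1 - 2 * ε := by linarith
  refine ⟨hD, hD.2.2.1, e₀, ⟨h2, (1, 0), ?_, ?_⟩, e₁, ⟨h0, (0, 1), ?_, ?_⟩,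
    e₂, ⟨h2, (-1, 1), ?_, ?_⟩, e₃, ⟨h0, (-1, 0), ?_, ?_⟩, e₄, ⟨h2, (0, -1), ?_, ?_⟩,
    e₅, ⟨h0, (1, -1), ?_, ?_⟩, fun v hv => ?_⟩
  on_goal 13 =>
    obtain ⟨w, hw, hl⟩ := hexagon_short_edge h0 h1 v hv
    exact ⟨⟨w, hw, hl⟩, fun h => lt_irrefl ε (h w ε hw hl)⟩
  all_goals first
  | exact Int.isCoprime_iff_gcd_eq_one.2 rfl
  | ext <;> simp [intVec] <;> ring
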